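/- There exists D > 0 depending only on C₀ such that the following holds: if ε, β > 0 satisfy β ≤ D²ε⁴, u is an admissible solution of (★) whose initial datum satisfies the data bounds with constant C₀, η ∈ C²(ℝ) has bounded first derivative, and T > 0, then there is a constant C depending only on C₀ such that ∫₀^T ∫_ℝ (β η′(u(t,x)) ∂_t∂_x u(t,x))² dx dt ≤ C ‖η′‖²_{L^∞(ℝ)} β/ε ≤ C ‖η′‖²_{L^∞(ℝ)} D² ε³ and ∫₀^T ∫_ℝ (β² η′(u(t,x)) ∂_t∂_x³ u(t,x))² dx dt ≤ C ‖η′‖²_{L^∞(ℝ)} β/ε ≤ C ‖η′‖²_{L^∞(ℝ)} D² ε³. In particular both quantities tend to 0 as ε → 0. -/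

import Mathlib

open MeasureTheory Real Filter Set

noncomputable section

/-- `mixedD u j k t x`: `j` time derivatives of the `k`-th spatial derivative of `u` at `(t,x)`. -/
def mixedD (u : ℝ → ℝ → ℝ) (j k : ℕ) (t x : ℝ) : ℝ :=
  iteratedDeriv j (fun s => iteratedDeriv k (fun y => u s y) x) t

/-- Squared `L²` norm in the space variable. -/
def sqL2 (f : ℝ → ℝ) : ℝ := ∫ x : ℝ, (f x) ^ 2

/-- `L²` norm in the space variable. -/
def nL2 (f : ℝ → ℝ) : ℝ := Real.sqrt (∫ x : ℝ, (f x) ^ 2)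

/-- `L⁴` norm in the space variable. -/
def nL4 (f : ℝ → ℝ) : ℝ := (∫ x : ℝ, (f x) ^ 4) ^ ((1 : ℝ) / 4)

/-- Admissible solution of the Rosenau–KdV–RLW approximation (★). -/
structure IsAdmissibleKdVRLW (ε β : ℝ) (u : ℝ → ℝ → ℝ) : Prop where
  smooth : ContDiff ℝ (⊤ : ℕ∞) (fun p : ℝ × ℝ => u p.1 p.2)
  pde : ∀ t > (0 : ℝ), ∀ x : ℝ,
    mixedD u 1 0 t x + deriv (fun y => (u t y) ^ 2) x
      + β * mixedD u 0 3 t x - β * mixedD u 1 2 t x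
      + β ^ 2 * mixedD u 1 4 t x = ε * mixedD u 0 2 t x
  sq_int : ∀ T > (0 : ℝ), ∀ j k : ℕ, j + k ≤ 5 → ∀ t ∈ Set.Icc (0 : ℝ) T,
    MeasureTheory.Integrable (fun x : ℝ => (mixedD u j k t x) ^ 2)
  decay : ∀ T > (0 : ℝ), ∀ j k : ℕ, j + k ≤ 5 → ∀ δ > (0 : ℝ), ∃ M : ℝ,
    ∀ x : ℝ, M ≤ |x| → ∀ t ∈ Set.Icc (0 : ℝ) T, |mixedD u j k t x| ≤ δ

/-- Admissible solution of the Rosenau–RLW approximation (★★). -/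
structure IsAdmissibleRLW (ε β : ℝ) (u : ℝ → ℝ → ℝ) : Prop where
  smooth : ContDiff ℝ (⊤ : ℕ∞) (fun p : ℝ × ℝ => u p.1 p.2)
  pde : ∀ t > (0 : ℝ), ∀ x : ℝ,
    mixedD u 1 0 t x + deriv (fun y => (u t y) ^ 2) x
      - β * mixedD u 1 2 t x + β ^ 2 * mixedD u 1 4 t x = ε * mixedD u 0 2 t x
  sq_int : ∀ T > (0 : ℝ), ∀ j k : ℕ, j + k ≤ 5 → ∀ t ∈ Set.Icc (0 : ℝ) T,
    MeasureTheory.Integrable (fun x : ℝ => (mixedD u j k t x) ^ 2)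
  decay : ∀ T > (0 : ℝ), ∀ j k : ℕ, j + k ≤ 5 → ∀ δ > (0 : ℝ), ∃ M : ℝ,
    ∀ x : ℝ, M ≤ |x| → ∀ t ∈ Set.Icc (0 : ℝ) T, |mixedD u j k t x| ≤ δ

/-- Data bounds with constant `C0` for the (★) approximation. -/
def DataBoundsKdVRLW (ε β C0 : ℝ) (f : ℝ → ℝ) : Prop :=
  (∫ x : ℝ, (f x) ^ 2) + (∫ x : ℝ, (f x) ^ 4)
      + (β + ε ^ 2) * (∫ x : ℝ, (deriv f x) ^ 2) ≤ C0 ∧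
  (β * ε + β * ε ^ 2 + β ^ 2) * (∫ x : ℝ, (iteratedDeriv 2 f x) ^ 2)
      + (β ^ 2 * ε ^ 2 + β ^ 3) * (∫ x : ℝ, (iteratedDeriv 3 f x) ^ 2) ≤ C0 ∧
  β ^ 4 * (∫ x : ℝ, (iteratedDeriv 4 f x) ^ 2) ≤ C0

/-- Data bounds with constant `C0` for the (★★) approximation. -/
def DataBoundsRLW (ε β C0 : ℝ) (f : ℝ → ℝ) : Prop :=
  (∫ x : ℝ, (f x) ^ 2) + (∫ x : ℝ, (f x) ^ 4)
    + β * ε ^ 2 * (∫ x : ℝ, (iteratedDeriv 2 f x) ^ 2) ≤ C0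

/-- `u ∈ L^∞((0,∞); L²(ℝ) ∩ L⁴(ℝ))`. -/
def BddL2L4 (u : ℝ → ℝ → ℝ) : Prop :=
  ∃ M : ℝ, ∀ t > (0 : ℝ), (∫ x : ℝ, (u t x) ^ 2) ≤ M ∧ (∫ x : ℝ, (u t x) ^ 4) ≤ M

/-- Entropy solution of `∂ₜ u + ∂ₓ (u²) = 0` with initial datum `u0`. -/
def IsEntropySolution (u : ℝ → ℝ → ℝ) (u0 : ℝ → ℝ) : Prop :=
  ∀ η : ℝ → ℝ, ContDiff ℝ 2 η → ConvexOn ℝ Set.univ η →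
    (∃ M : ℝ, ∀ v : ℝ, |deriv η v| ≤ M) →
    ∀ φ : ℝ → ℝ → ℝ, ContDiff ℝ (⊤ : ℕ∞) (fun p : ℝ × ℝ => φ p.1 p.2) →
      HasCompactSupport (fun p : ℝ × ℝ => φ p.1 p.2) →
      (∀ t x : ℝ, 0 ≤ φ t x) →
      0 ≤ (∫ t in Set.Ioi (0 : ℝ), ∫ x : ℝ,
            (η (u t x) * deriv (fun s => φ s x) t
              + (∫ ξ in (0 : ℝ)..(u t x), 2 * ξ * deriv η ξ) * deriv (fun y => φ t y) x))
          + ∫ x : ℝ, η (u0 x) * φ 0 x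


open scoped Topology ContDiff

section Smooth

variable {F : ℝ × ℝ → ℝ}

theorem hasDerivAt_snd_of_contDiff (hF : ContDiff ℝ ∞ F) (t x : ℝ) :
    HasDerivAt (fun y => F (t, y)) (fderiv ℝ F (t, x) (0, 1)) x :=
  ((hF.differentiable (by simp)) (t, x)).hasFDerivAt.comp_hasDerivAt x
    ((hasDerivAt_const x t).prodMk (hasDerivAt_id x))

theorem hasDerivAt_fst_of_contDiff (hF : ContDiff ℝ ∞ F) (t x : ℝ) :
    HasDerivAt (fun s => F (s, x)) (fderiv ℝ F (t, x) (1, 0)) t :=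
  ((hF.differentiable (by simp)) (t, x)).hasFDerivAt.comp_hasDerivAt t
    ((hasDerivAt_id t).prodMk (hasDerivAt_const t x))

theorem contDiff_fderiv_apply (hF : ContDiff ℝ ∞ F) (v : ℝ × ℝ) :
    ContDiff ℝ ∞ fun p => fderiv ℝ F p v :=
  (hF.fderiv_right (m := ∞) (by simp)).clm_apply contDiff_const

theorem fderiv_fderiv_apply_comm (hF : ContDiff ℝ ∞ F) (p v w : ℝ × ℝ) :
    fderiv ℝ (fun q => fderiv ℝ F q v) p w = fderiv ℝ (fun q => fderiv ℝ F q w) p v := by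
  have hd : DifferentiableAt ℝ (fderiv ℝ F) p :=
    (hF.fderiv_right (m := ∞) (by simp)).differentiable (by simp) p
  have key (a b : ℝ × ℝ) :
      fderiv ℝ (fun q => fderiv ℝ F q a) p b = fderiv ℝ (fderiv ℝ F) p b a := by
    rw [fderiv_clm_apply hd (differentiableAt_const a)]
    simp
  rw [key, key]
  exact (hF.contDiffAt.isSymmSndFDerivAt (by
    rw [minSmoothness_of_isRCLikeNormedField]
    exact WithTop.coe_le_coe.2 (le_top : (2 : ℕ∞) ≤ ⊤))) w v

end Smooth

section MixedD

variable {u : ℝ → ℝ → ℝ}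

theorem hasDerivAt_iteratedDeriv_snd (hu : ContDiff ℝ ∞ fun p : ℝ × ℝ => u p.1 p.2) (k : ℕ) :
    ContDiff ℝ ∞ (fun p : ℝ × ℝ => mixedD u 0 k p.1 p.2) ∧
      ∀ t x, HasDerivAt (mixedD u 0 k t) (mixedD u 0 (k + 1) t x) x := by
  have step (k : ℕ) (h : ContDiff ℝ ∞ (fun p : ℝ × ℝ => mixedD u 0 k p.1 p.2)) (t x : ℝ) :
      mixedD u 0 (k + 1) t x
        = fderiv ℝ (fun p : ℝ × ℝ => mixedD u 0 k p.1 p.2) (t, x) (0, 1) := by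
    have := (hasDerivAt_snd_of_contDiff h t x).deriv
    rw [← this]
    simp only [mixedD, iteratedDeriv_zero, iteratedDeriv_succ]
  have smooth : ContDiff ℝ ∞ (fun p : ℝ × ℝ => mixedD u 0 k p.1 p.2) := by
    induction k with
    | zero => simpa [mixedD] using hu
    | succ k ih =>
      have : (fun p : ℝ × ℝ => mixedD u 0 (k + 1) p.1 p.2)
          = fun p => fderiv ℝ (fun p : ℝ × ℝ => mixedD u 0 k p.1 p.2) p (0, 1) :=
        funext fun p => step k ih p.1 p.2
      rw [this]
      exact contDiff_fderiv_apply ih _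
  exact ⟨smooth, fun t x => step k smooth t x ▸ hasDerivAt_snd_of_contDiff smooth t x⟩

theorem mixedD_one_eq (hu : ContDiff ℝ ∞ fun p : ℝ × ℝ => u p.1 p.2) (k : ℕ) (p : ℝ × ℝ) :
    mixedD u 1 k p.1 p.2
      = fderiv ℝ (fun p : ℝ × ℝ => mixedD u 0 k p.1 p.2) p (1, 0) := by
  rw [← (hasDerivAt_fst_of_contDiff (hasDerivAt_iteratedDeriv_snd hu k).1 p.1 p.2).deriv]
  simp only [mixedD, iteratedDeriv_zero, iteratedDeriv_one]

theorem contDiff_mixedD_one (hu : ContDiff ℝ ∞ fun p : ℝ × ℝ => u p.1 p.2) (k : ℕ) :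
    ContDiff ℝ ∞ (fun p : ℝ × ℝ => mixedD u 1 k p.1 p.2) := by
  rw [funext fun p => mixedD_one_eq hu k p]
  exact contDiff_fderiv_apply (hasDerivAt_iteratedDeriv_snd hu k).1 _

theorem hasDerivAt_mixedD_fst (hu : ContDiff ℝ ∞ fun p : ℝ × ℝ => u p.1 p.2) (k : ℕ) (t x : ℝ) :
    HasDerivAt (fun s => mixedD u 0 k s x) (mixedD u 1 k t x) t :=
  mixedD_one_eq hu k (t, x) ▸ hasDerivAt_fst_of_contDiff (hasDerivAt_iteratedDeriv_snd hu k).1 t x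

theorem hasDerivAt_mixedD_one_snd (hu : ContDiff ℝ ∞ fun p : ℝ × ℝ => u p.1 p.2) (k : ℕ)
    (t x : ℝ) : HasDerivAt (mixedD u 1 k t) (mixedD u 1 (k + 1) t x) x := by
  have h := hasDerivAt_snd_of_contDiff (contDiff_mixedD_one hu k) t x
  obtain ⟨hk, hk'⟩ := hasDerivAt_iteratedDeriv_snd hu k
  have hx : (fun q : ℝ × ℝ => fderiv ℝ (fun p : ℝ × ℝ => mixedD u 0 k p.1 p.2) q (0, 1))
      = fun q => mixedD u 0 (k + 1) q.1 q.2 :=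
    funext fun q => (hasDerivAt_snd_of_contDiff hk q.1 q.2).unique (hk' q.1 q.2)
  have hd : fderiv ℝ (fun p : ℝ × ℝ => mixedD u 1 k p.1 p.2) (t, x) (0, 1)
      = mixedD u 1 (k + 1) t x := by
    rw [funext fun p => mixedD_one_eq hu k p, fderiv_fderiv_apply_comm hk, hx,
      ← mixedD_one_eq hu (k + 1) (t, x)]
  exact hd ▸ h

end MixedD

/-- A balance law `∂ₜ e + ∂ₓ f + d ≤ 0` with vanishing flux at infinity controls the energy and
the dissipation on every bounded interval by the initial energy. -/
theorem energy_add_dissipation_le {e et f fx d : ℝ → ℝ → ℝ} {T : ℝ} (hT : 0 ≤ T)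
    (het : Continuous (Function.uncurry et)) (hfx : Continuous (Function.uncurry fx))
    (hd : Continuous (Function.uncurry d)) (hec : ∀ t, Continuous (e t))
    (he : ∀ t x, HasDerivAt (fun s => e s x) (et t x) t)
    (hf : ∀ t x, HasDerivAt (f t) (fx t x) x)
    (he0 : ∀ t x, 0 ≤ e t x) (hd0 : ∀ t x, 0 ≤ d t x) (hint : Integrable (e 0))
    (hineq : ∀ t ∈ Ioo 0 T, ∀ x, et t x + fx t x + d t x ≤ 0)
    (hflux : Tendsto (fun p : ℝ × ℝ => f p.1 p.2) (𝓟 (Icc 0 T) ×ˢ cocompact ℝ) (𝓝 0))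
    {R : ℝ} (hR : 0 ≤ R) :
    (∫ x in -R..R, e T x) + ∫ t in (0 : ℝ)..T, ∫ x in -R..R, d t x ≤ ∫ x, e 0 x := by
  refine le_of_forall_pos_le_add fun δ hδ => ?_
  have hδ' : 0 < δ / (2 * T + 1) := by positivity
  obtain ⟨S, hRS, hS⟩ : ∃ S, R ≤ S ∧ ∀ t ∈ Icc 0 T,
      |f t S| ≤ δ / (2 * T + 1) ∧ |f t (-S)| ≤ δ / (2 * T + 1) := by
    have h := hflux (Metric.closedBall_mem_nhds 0 hδ')
    rw [mem_map, mem_prod_iff] at h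
    obtain ⟨A, hA, B, hB, hAB⟩ := h
    rw [mem_principal] at hA
    rw [← Metric.cobounded_eq_cocompact] at hB
    have h1 : ∀ᶠ S : ℝ in atTop, S ∈ B :=
      (tendsto_atTop_atTop.2 fun b => ⟨b, fun a h => h⟩ : Tendsto (fun S : ℝ => S) atTop atTop)
        |>.mono_right (by rw [IsOrderBornology.cobounded_eq]; exact le_sup_right) hB
    have h2 : ∀ᶠ S : ℝ in atTop, -S ∈ B :=
      tendsto_neg_atTop_atBot.mono_right
        (by rw [IsOrderBornology.cobounded_eq]; exact le_sup_left) hB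
    obtain ⟨S, hS1, hS2, hS3⟩ := (h1.and (h2.and (eventually_ge_atTop R))).exists
    refine ⟨S, hS3, fun t ht => ⟨?_, ?_⟩⟩
    · simpa using hAB (Set.mk_mem_prod (hA ht) hS1)
    · simpa using hAB (Set.mk_mem_prod (hA ht) hS2)
  have hS0 : -S ≤ S := by linarith
  have cx {g : ℝ → ℝ → ℝ} (hg : Continuous (Function.uncurry g)) (t : ℝ) : Continuous (g t) :=
    hg.comp (by fun_prop : Continuous fun x : ℝ => (t, x))
  have ct {g : ℝ → ℝ → ℝ} (hg : Continuous (Function.uncurry g)) (x : ℝ) :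
      Continuous fun t => g t x :=
    hg.comp (by fun_prop : Continuous fun t : ℝ => (t, x))
  have cI {g : ℝ → ℝ → ℝ} (hg : Continuous (Function.uncurry g)) (a b : ℝ) :
      Continuous fun t => ∫ x in a..b, g t x :=
    intervalIntegral.continuous_parametric_intervalIntegral_of_continuous' hg a b
  have h_et : (∫ t in (0 : ℝ)..T, ∫ x in -S..S, et t x)
      = (∫ x in -S..S, e T x) - ∫ x in -S..S, e 0 x := by
    rw [intervalIntegral_intervalIntegral_swap,
      ← intervalIntegral.integral_sub ((hec T).intervalIntegrable _ _)
        ((hec 0).intervalIntegrable _ _)]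
    · refine intervalIntegral.integral_congr fun x _ => ?_
      exact intervalIntegral.integral_eq_sub_of_hasDerivAt (fun t _ => he t x)
        ((ct het x).intervalIntegrable _ _)
    · refine (het.continuousOn.integrableOn_compact
        (K := uIcc 0 T ×ˢ uIcc (-S) S) (isCompact_uIcc.prod isCompact_uIcc)).mono_set ?_
      exact Set.prod_mono uIoc_subset_uIcc uIoc_subset_uIcc
  have h_fx : -δ ≤ ∫ t in (0 : ℝ)..T, ∫ x in -S..S, fx t x := by
    have h1 : (∫ _ in (0 : ℝ)..T, -(2 * (δ / (2 * T + 1))))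
        ≤ ∫ t in (0 : ℝ)..T, ∫ x in -S..S, fx t x := by
      refine intervalIntegral.integral_mono_on hT (by simp) ((cI hfx _ _).intervalIntegrable _ _)
        fun t ht => ?_
      rw [intervalIntegral.integral_eq_sub_of_hasDerivAt (fun x _ => hf t x)
        ((cx hfx t).intervalIntegrable _ _)]
      have := hS t ht
      linarith [(abs_le.1 this.1).1, (abs_le.1 this.2).2]
    rw [intervalIntegral.integral_const, smul_eq_mul] at h1
    have h2 : (T - 0) * -(2 * (δ / (2 * T + 1))) = -(δ - δ / (2 * T + 1)) := by
      field_simp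
      ring
    linarith
  have integral_add_three (a b : ℝ) {g₁ g₂ g₃ : ℝ → ℝ} (h₁ : Continuous g₁) (h₂ : Continuous g₂)
      (h₃ : Continuous g₃) : (∫ x in a..b, (g₁ x + g₂ x + g₃ x))
        = (∫ x in a..b, g₁ x) + (∫ x in a..b, g₂ x) + ∫ x in a..b, g₃ x := by
    rw [intervalIntegral.integral_add ((h₁.fun_add h₂).intervalIntegrable _ _)
      (h₃.intervalIntegrable _ _), intervalIntegral.integral_add (h₁.intervalIntegrable _ _)
      (h₂.intervalIntegrable _ _)]
  have h_sum : (∫ t in (0 : ℝ)..T, ∫ x in -S..S, et t x)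
      + (∫ t in (0 : ℝ)..T, ∫ x in -S..S, fx t x)
      + (∫ t in (0 : ℝ)..T, ∫ x in -S..S, d t x) ≤ 0 := by
    rw [← integral_add_three 0 T (cI het _ _) (cI hfx _ _) (cI hd _ _)]
    have h0 : (∫ _ in (0 : ℝ)..T, (0 : ℝ)) = 0 := intervalIntegral.integral_zero
    refine le_of_le_of_eq (intervalIntegral.integral_mono_on_of_le_Ioo hT
      ((((cI het _ _).add (cI hfx _ _)).add (cI hd _ _)).intervalIntegrable _ _) (by simp)
      fun t ht => ?_) h0
    rw [← integral_add_three (-S) S (cx het t) (cx hfx t) (cx hd t)]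
    have h1 : (∫ _ in -S..S, (0 : ℝ)) = 0 := by simp
    exact le_of_le_of_eq (intervalIntegral.integral_mono_on hS0
      ((((cx het t).add (cx hfx t)).add (cx hd t)).intervalIntegrable _ _) (by simp)
      fun x _ => hineq t ht x) h1
  have mono {g : ℝ → ℝ} (hg : Continuous g) (hg0 : ∀ x, 0 ≤ g x) :
      (∫ x in -R..R, g x) ≤ ∫ x in -S..S, g x :=
    intervalIntegral.integral_mono_interval (by linarith) (by linarith) hRS
      (.of_forall hg0) (hg.intervalIntegrable _ _)
  have h_d : (∫ t in (0 : ℝ)..T, ∫ x in -R..R, d t x)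
      ≤ ∫ t in (0 : ℝ)..T, ∫ x in -S..S, d t x :=
    intervalIntegral.integral_mono_on hT ((cI hd _ _).intervalIntegrable _ _)
      ((cI hd _ _).intervalIntegrable _ _) fun t _ => mono (cx hd t) (hd0 t)
  have h_init : (∫ x in -S..S, e 0 x) ≤ ∫ x, e 0 x := by
    rw [intervalIntegral.integral_of_le hS0]
    exact setIntegral_le_integral hint (.of_forall (he0 0))
  linarith [mono (hec T) (he0 T)]

theorem mul_sq_le_of_integral_le {f f' : ℝ → ℝ} {s K : ℝ}
    (hf : ∀ x, HasDerivAt f (f' x) x) (hf' : Continuous f')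
    (hlim : Tendsto f (cocompact ℝ) (𝓝 0))
    (hK : ∀ R, 0 ≤ R → (∫ x in -R..R, (f x ^ 2 + s ^ 2 * f' x ^ 2)) ≤ K) (x : ℝ) :
    s * f x ^ 2 ≤ K := by
  have hfc : Continuous f := continuous_iff_continuousAt.2 fun x => (hf x).continuousAt
  have hbot : Tendsto (fun R : ℝ => f (-R)) atTop (𝓝 0) :=
    hlim.comp (tendsto_neg_atTop_atBot.mono_right atBot_le_cocompact)
  have hlim' : Tendsto (fun R : ℝ => K + s * f (-R) ^ 2) atTop (𝓝 K) := by
    simpa using ((hbot.pow 2).const_mul s).const_add K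
  refine ge_of_tendsto hlim' ?_
  filter_upwards [eventually_ge_atTop |x|] with R hR
  obtain ⟨h1, h2⟩ := abs_le.1 hR
  have hg : Continuous fun y => f y ^ 2 + s ^ 2 * f' y ^ 2 := by fun_prop
  have hprim : (∫ y in -R..x, s * (2 * f y * f' y)) = s * f x ^ 2 - s * f (-R) ^ 2 := by
    refine intervalIntegral.integral_eq_sub_of_hasDerivAt
      (f := fun y => s * f y ^ 2) (fun y _ => ?_)
      ((by fun_prop : Continuous fun y => s * (2 * f y * f' y)).intervalIntegrable _ _)
    exact (((hf y).fun_pow 2).const_mul s).congr_deriv (by ring)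
  have hle : (∫ y in -R..x, s * (2 * f y * f' y))
      ≤ ∫ y in -R..x, (f y ^ 2 + s ^ 2 * f' y ^ 2) := by
    refine intervalIntegral.integral_mono_on h1
      ((by fun_prop : Continuous fun y => s * (2 * f y * f' y)).intervalIntegrable _ _)
      (hg.intervalIntegrable _ _) fun y _ => ?_
    nlinarith [sq_nonneg (f y - s * f' y)]
  have hext : (∫ y in -R..x, (f y ^ 2 + s ^ 2 * f' y ^ 2))
      ≤ ∫ y in -R..R, (f y ^ 2 + s ^ 2 * f' y ^ 2) :=
    intervalIntegral.integral_mono_interval le_rfl h1 h2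
      (.of_forall fun y => by positivity) (hg.intervalIntegrable _ _)
  linarith [hK R ((abs_nonneg x).trans hR)]

theorem integral_integral_sq_le {g h : ℝ → ℝ → ℝ} {T K m : ℝ} (hT : 0 ≤ T) (hm : 0 ≤ m)
    (hg : Continuous (Function.uncurry g)) (hh : Continuous (Function.uncurry h))
    (hle : ∀ t x, h t x ^ 2 ≤ m * g t x ^ 2)
    (hint : ∀ t ∈ Icc 0 T, Integrable fun x => g t x ^ 2)
    (hK : ∀ R, 0 ≤ R → (∫ t in (0 : ℝ)..T, ∫ x in -R..R, g t x ^ 2) ≤ K) :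
    (∫ t in (0 : ℝ)..T, ∫ x, h t x ^ 2) ≤ m * K := by
  have hK0 : 0 ≤ m * K := mul_nonneg hm (by simpa using hK 0 le_rfl)
  by_cases hF : IntervalIntegrable (fun t => ∫ x, h t x ^ 2) volume 0 T
  swap
  · rwa [intervalIntegral.integral_undef hF]
  have sec {k : ℝ → ℝ → ℝ} (hk : Continuous (Function.uncurry k)) (t : ℝ) : Continuous (k t) :=
    hk.comp (by fun_prop : Continuous fun x : ℝ => (t, x))
  have par {k : ℝ → ℝ → ℝ} (hk : Continuous (Function.uncurry k)) (R : ℝ) :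
      Continuous fun t => ∫ x in -R..R, k t x ^ 2 :=
    intervalIntegral.continuous_parametric_intervalIntegral_of_continuous'
      (f := fun t x => k t x ^ 2) (by simpa only [Function.uncurry_def] using hk.fun_pow 2) _ _
  have hint' (t : ℝ) (ht : t ∈ Icc 0 T) : Integrable fun x => h t x ^ 2 :=
    ((hint t ht).const_mul m).mono' ((sec hh t).pow 2).aestronglyMeasurable
      (.of_forall fun x => by
        rw [Real.norm_of_nonneg (sq_nonneg _)]
        exact hle t x)
  have hlim : Tendsto (fun n : ℕ => ∫ t in (0 : ℝ)..T, ∫ x in -(n : ℝ)..n, h t x ^ 2) atTop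
      (𝓝 (∫ t in (0 : ℝ)..T, ∫ x, h t x ^ 2)) := by
    simp only [intervalIntegral.integral_of_le hT]
    refine integral_tendsto_of_tendsto_of_monotone
      (fun n => (((par hh n).intervalIntegrable 0 T).1)) hF.1 ?_ ?_
    · refine .of_forall fun t n k hnk => ?_
      have : (n : ℝ) ≤ k := by exact_mod_cast hnk
      exact intervalIntegral.integral_mono_interval (by linarith)
        (by linarith [(n.cast_nonneg : (0 : ℝ) ≤ n)]) this
        (.of_forall fun y => sq_nonneg _) (((sec hh t).pow 2).intervalIntegrable _ _)
    · filter_upwards [ae_restrict_mem measurableSet_Ioc] with t ht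
      exact intervalIntegral_tendsto_integral (hint' t (Ioc_subset_Icc_self ht))
        (tendsto_neg_atTop_atBot.comp tendsto_natCast_atTop_atTop) tendsto_natCast_atTop_atTop
  refine le_of_tendsto' hlim fun n => ?_
  calc (∫ t in (0 : ℝ)..T, ∫ x in -(n : ℝ)..n, h t x ^ 2)
      ≤ ∫ t in (0 : ℝ)..T, m * ∫ x in -(n : ℝ)..n, g t x ^ 2 := by
        refine intervalIntegral.integral_mono_on hT ((par hh n).intervalIntegrable _ _)
          (((par hg n).const_mul m).intervalIntegrable _ _) fun t _ => ?_
        rw [← intervalIntegral.integral_const_mul]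
        exact intervalIntegral.integral_mono_on
          (by linarith [(n.cast_nonneg : (0 : ℝ) ≤ n)])
          (((sec hh t).pow 2).intervalIntegrable _ _)
          ((((sec hg t).pow 2).const_mul m).intervalIntegrable _ _) fun x _ => hle t x
    _ = m * ∫ t in (0 : ℝ)..T, ∫ x in -(n : ℝ)..n, g t x ^ 2 :=
        intervalIntegral.integral_const_mul _ _
    _ ≤ m * K := mul_le_mul_of_nonneg_left (hK n n.cast_nonneg) hm

/-- Pointwise form of the higher-order energy estimate: `aₖ`, `bₖ` stand for the `k`-th spatial
derivatives of `u` and of `∂ₜ u`. -/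
theorem higher_energy_pointwise {ε β a0 a1 a2 a3 b0 b1 b2 b3 b4 : ℝ} (hε : 0 < ε) (hβ : 0 < β)
    (hpde : b0 + 2 * a0 * a1 + β * a3 - β * b2 + β ^ 2 * b4 = ε * a2)
    (hsmall : β * a0 ^ 2 ≤ ε ^ 2 / 9) :
    (2 * a0 * b0 + 6 * β * a1 * b1 + 6 * β ^ 2 * a2 * b2 + 4 * β ^ 3 * a3 * b3
        + 2 * β * ε ^ 2 * a2 * b2 + 2 * a0 ^ 3 * b0)
      + ((4 * a0 ^ 2 * a1 + 2 * β * a0 * a3 - 2 * β * (a1 * b1 + a0 * b2)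
            + 2 * β ^ 2 * (a0 * b4 - a2 * b2) - 2 * ε * (a1 ^ 2 + a0 * a2))
        + 2 * (-2 * β * (a2 * b0 + a1 * b1) - 2 * β ^ 3 * (a3 * b3 + a2 * b4)
            - 2 * β ^ 2 * a2 * a3)
        + (-2 * β * ε * (b1 ^ 2 + b0 * b2) - 2 * β ^ 2 * ε * (a3 * b2 + a2 * b3)
            - 2 * β ^ 3 * ε * (b3 ^ 2 + b2 * b4))
        + (4 * a0 ^ 4 * a1 + 2 * β * (3 * a0 ^ 2 * a1 * a2 + a0 ^ 3 * a3)
            - 2 * β * (3 * a0 ^ 2 * a1 * b1 + a0 ^ 3 * b2)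
            + 2 * β ^ 2 * (3 * a0 ^ 2 * a1 * b3 + a0 ^ 3 * b4)
            - 2 * ε * (3 * a0 ^ 2 * a1 ^ 2 + a0 ^ 3 * a2)))
      + (β * ε * b1 ^ 2 + β ^ 3 * ε * b3 ^ 2) ≤ 0 := by
  obtain ⟨r, hr⟩ : ∃ r, r = β / ε := ⟨_, rfl⟩
  have hr0 : 0 < r := hr ▸ div_pos hβ hε
  have hrβ : β = r * ε := by rw [hr]; field_simp
  have hs : 0 ≤ ε / 9 - r * a0 ^ 2 := by
    have : 0 ≤ ε * (ε / 9 - r * a0 ^ 2) := by rw [hrβ] at hsmall; linarith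
    exact nonneg_of_mul_nonneg_right this hε
  have q1 : 0 ≤ 2 * ε * (β * b2 - a0 * a1) ^ 2 := by positivity
  have q2 : 0 ≤ β * ε / 2 * (β * b3 + 2 * a2) ^ 2 := by positivity
  have q3 : 0 ≤ r * (ε * a2 - 3 * a0 ^ 2 * a1) ^ 2 := by positivity
  have q4 : 0 ≤ r * (ε * b1 + 3 * a0 ^ 2 * a1) ^ 2 := by positivity
  have q5 : 0 ≤ r / 2 * (β * ε * b3 - 6 * a0 ^ 2 * a1) ^ 2 := by positivity
  have q6 : 0 ≤ r * (ε * a2 - 4 * a0 * a1) ^ 2 := by positivity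
  have q7 : 0 ≤ (ε / 9 - r * a0 ^ 2) * (36 * a0 ^ 2 * a1 ^ 2 + 16 * a1 ^ 2) :=
    mul_nonneg hs (by positivity)
  have q8 : 0 ≤ 2 / 9 * ε * a1 ^ 2 := by positivity
  have hmul := congrArg (fun z => (2 * a0 - 4 * β * a2 - 2 * β * ε * b2 + 2 * a0 ^ 3) * z) hpde
  subst hrβ
  linarith

section Admissible

variable {ε β : ℝ} {u : ℝ → ℝ → ℝ}

theorem IsAdmissibleKdVRLW.tendsto_mixedD (h : IsAdmissibleKdVRLW ε β u) {T : ℝ} (hT : 0 ≤ T)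
    {j k : ℕ} (hjk : j + k ≤ 5) :
    Tendsto (fun p : ℝ × ℝ => mixedD u j k p.1 p.2) (𝓟 (Icc 0 T) ×ˢ cocompact ℝ) (𝓝 0) := by
  rw [Metric.tendsto_nhds]
  intro δ hδ
  obtain ⟨M, hM⟩ := h.decay (T + 1) (by linarith) j k hjk (δ / 2) (half_pos hδ)
  have h1 : ∀ᶠ t in 𝓟 (Icc 0 T), t ∈ Icc 0 T := eventually_principal.2 fun _ => id
  have h2 : ∀ᶠ x : ℝ in cocompact ℝ, M ≤ |x| :=
    (tendsto_norm_cocompact_atTop (E := ℝ)).eventually_ge_atTop M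
  filter_upwards [h1.prod_mk h2] with p hp
  rw [Real.dist_eq, sub_zero]
  have := hM p.2 hp.2 p.1 ⟨hp.1.1, hp.1.2.trans (by linarith)⟩
  linarith

theorem IsAdmissibleKdVRLW.pde_mixedD (h : IsAdmissibleKdVRLW ε β u) {t : ℝ} (ht : 0 < t)
    (x : ℝ) :
    mixedD u 1 0 t x + 2 * mixedD u 0 0 t x * mixedD u 0 1 t x + β * mixedD u 0 3 t x
      - β * mixedD u 1 2 t x + β ^ 2 * mixedD u 1 4 t x = ε * mixedD u 0 2 t x := by
  have hd : deriv (fun y => u t y ^ 2) x = 2 * mixedD u 0 0 t x * mixedD u 0 1 t x := by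
    have := (((hasDerivAt_iteratedDeriv_snd h.smooth 0).2 t x).fun_pow 2).deriv
    simp only [mixedD, iteratedDeriv_zero] at this ⊢
    rw [this]
    ring
  rw [← hd]
  exact h.pde t ht x

theorem IsAdmissibleKdVRLW.integral_energy_le (h : IsAdmissibleKdVRLW ε β u) (hε : 0 < ε)
    (hβ : 0 < β) {T : ℝ} (hT : 0 ≤ T) {R : ℝ} (hR : 0 ≤ R) :
    (∫ x in -R..R, (mixedD u 0 0 T x ^ 2 + β * mixedD u 0 1 T x ^ 2
        + β ^ 2 * mixedD u 0 2 T x ^ 2))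
      ≤ ∫ x, (mixedD u 0 0 0 x ^ 2 + β * mixedD u 0 1 0 x ^ 2
        + β ^ 2 * mixedD u 0 2 0 x ^ 2) := by
  have cA (k : ℕ) : Continuous fun p : ℝ × ℝ => mixedD u 0 k p.1 p.2 :=
    (hasDerivAt_iteratedDeriv_snd h.smooth k).1.continuous
  have cB (k : ℕ) : Continuous fun p : ℝ × ℝ => mixedD u 1 k p.1 p.2 :=
    (contDiff_mixedD_one h.smooth k).continuous
  have cA' (k : ℕ) (t : ℝ) : Continuous fun x : ℝ => mixedD u 0 k t x :=
    (cA k).comp (by fun_prop : Continuous fun x : ℝ => (t, x))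
  have dt (k : ℕ) := hasDerivAt_mixedD_fst h.smooth k
  have dA (k : ℕ) := (hasDerivAt_iteratedDeriv_snd h.smooth k).2
  have dB (k : ℕ) := hasDerivAt_mixedD_one_snd h.smooth k
  have int (k : ℕ) (hk : k ≤ 5) : Integrable fun x => mixedD u 0 k 0 x ^ 2 :=
    h.sq_int 1 one_pos 0 k (by omega) 0 (by simp)
  have lim {j k : ℕ} (hjk : j + k ≤ 5) := h.tendsto_mixedD hT hjk
  have key := energy_add_dissipation_le (T := T) (R := R)
    (e := fun t x => mixedD u 0 0 t x ^ 2 + β * mixedD u 0 1 t x ^ 2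
        + β ^ 2 * mixedD u 0 2 t x ^ 2)
    (et := fun t x => 2 * mixedD u 0 0 t x * mixedD u 1 0 t x
        + 2 * β * mixedD u 0 1 t x * mixedD u 1 1 t x
        + 2 * β ^ 2 * mixedD u 0 2 t x * mixedD u 1 2 t x)
    (f := fun t x => 4 / 3 * mixedD u 0 0 t x ^ 3
        + 2 * β * (mixedD u 0 0 t x * mixedD u 0 2 t x) - β * mixedD u 0 1 t x ^ 2
        - 2 * β * (mixedD u 0 0 t x * mixedD u 1 1 t x)
        + 2 * β ^ 2 * (mixedD u 0 0 t x * mixedD u 1 3 t x)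
        - 2 * β ^ 2 * (mixedD u 0 1 t x * mixedD u 1 2 t x)
        - 2 * ε * (mixedD u 0 0 t x * mixedD u 0 1 t x))
    (fx := fun t x => 4 * mixedD u 0 0 t x ^ 2 * mixedD u 0 1 t x
        + 2 * β * mixedD u 0 0 t x * mixedD u 0 3 t x
        - 2 * β * (mixedD u 0 1 t x * mixedD u 1 1 t x + mixedD u 0 0 t x * mixedD u 1 2 t x)
        + 2 * β ^ 2 * (mixedD u 0 0 t x * mixedD u 1 4 t x - mixedD u 0 2 t x * mixedD u 1 2 t x)
        - 2 * ε * (mixedD u 0 1 t x ^ 2 + mixedD u 0 0 t x * mixedD u 0 2 t x))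
    (d := fun t x => 2 * ε * mixedD u 0 1 t x ^ 2) hT
    (by simp only [Function.uncurry_def]; fun_prop) (by simp only [Function.uncurry_def]; fun_prop)
    (by simp only [Function.uncurry_def]; fun_prop) (fun t => by fun_prop)
    (fun t x => ((((dt 0 t x).fun_pow 2).fun_add (((dt 1 t x).fun_pow 2).const_mul β)).fun_add
      (((dt 2 t x).fun_pow 2).const_mul (β ^ 2))).congr_deriv (by ring))
    (fun t x => (((((((((dA 0 t x).fun_pow 3).const_mul (4 / 3)).fun_add
      (((dA 0 t x).fun_mul (dA 2 t x)).const_mul (2 * β))).fun_sub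
      (((dA 1 t x).fun_pow 2).const_mul β)).fun_sub
      (((dA 0 t x).fun_mul (dB 1 t x)).const_mul (2 * β))).fun_add
      (((dA 0 t x).fun_mul (dB 3 t x)).const_mul (2 * β ^ 2))).fun_sub
      (((dA 1 t x).fun_mul (dB 2 t x)).const_mul (2 * β ^ 2))).fun_sub
      (((dA 0 t x).fun_mul (dA 1 t x)).const_mul (2 * ε))).congr_deriv (by push_cast; ring))
    (fun t x => by positivity) (fun t x => by positivity)
    (((int 0 (by simp)).add ((int 1 (by simp)).const_mul β)).add
      ((int 2 (by simp)).const_mul (β ^ 2)))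
    (fun t ht x => by
      have hmul := congrArg (fun z => 2 * mixedD u 0 0 t x * z) (h.pde_mixedD ht.1 x)
      linarith)
    (by
      have h00 := lim (j := 0) (k := 0) (by norm_num)
      have h01 := lim (j := 0) (k := 1) (by norm_num)
      have h02 := lim (j := 0) (k := 2) (by norm_num)
      have h11 := lim (j := 1) (k := 1) (by norm_num)
      have h12 := lim (j := 1) (k := 2) (by norm_num)
      have h13 := lim (j := 1) (k := 3) (by norm_num)
      have := ((((((h00.pow 3).const_mul (4 / 3)).add
        ((h00.mul h02).const_mul (2 * β))).sub ((h01.pow 2).const_mul β)).sub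
        ((h00.mul h11).const_mul (2 * β))).add ((h00.mul h13).const_mul (2 * β ^ 2))).sub
        ((h01.mul h12).const_mul (2 * β ^ 2)) |>.sub ((h00.mul h01).const_mul (2 * ε))
      convert this using 2
      simp)
    hR
  refine le_trans (le_add_of_nonneg_right ?_) key
  refine intervalIntegral.integral_nonneg hT fun t _ => ?_
  exact intervalIntegral.integral_nonneg (by linarith) fun x _ => by positivity

theorem IsAdmissibleKdVRLW.sqrt_mul_sq_le (h : IsAdmissibleKdVRLW ε β u) (hε : 0 < ε)
    (hβ : 0 < β) {K : ℝ} (hK : (∫ x, (mixedD u 0 0 0 x ^ 2 + β * mixedD u 0 1 0 x ^ 2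
      + β ^ 2 * mixedD u 0 2 0 x ^ 2)) ≤ K) {t : ℝ} (ht : 0 ≤ t) (x : ℝ) :
    √β * mixedD u 0 0 t x ^ 2 ≤ K := by
  have cA (k : ℕ) : Continuous fun x : ℝ => mixedD u 0 k t x :=
    (hasDerivAt_iteratedDeriv_snd h.smooth k).1.continuous.comp
      (by fun_prop : Continuous fun x : ℝ => (t, x))
  have hsec : Tendsto (fun x : ℝ => (t, x)) (cocompact ℝ) (𝓟 (Icc 0 t) ×ˢ cocompact ℝ) :=
    (tendsto_principal.2 (.of_forall fun _ => right_mem_Icc.2 ht)).prodMk tendsto_id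
  have hlim : Tendsto (mixedD u 0 0 t) (cocompact ℝ) (𝓝 0) :=
    (h.tendsto_mixedD (j := 0) (k := 0) ht (by norm_num)).comp hsec
  refine mul_sq_le_of_integral_le ((hasDerivAt_iteratedDeriv_snd h.smooth 0).2 t) (cA 1)
    hlim (fun R hR => ?_) x
  refine le_trans ?_ ((h.integral_energy_le hε hβ ht hR).trans hK)
  rw [Real.sq_sqrt hβ.le]
  refine intervalIntegral.integral_mono_on (by linarith)
    (Continuous.intervalIntegrable (by have := cA 0; have := cA 1; fun_prop) _ _)
    (Continuous.intervalIntegrable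
      (by have := cA 0; have := cA 1; have := cA 2; fun_prop) _ _) fun y _ => ?_
  exact le_add_of_nonneg_right (by positivity)

theorem IsAdmissibleKdVRLW.integral_higher_dissipation_le (h : IsAdmissibleKdVRLW ε β u)
    (hε : 0 < ε) (hβ : 0 < β)
    (hsmall : ∀ t, 0 ≤ t → ∀ x, β * mixedD u 0 0 t x ^ 2 ≤ ε ^ 2 / 9)
    (hint : Integrable fun x => mixedD u 0 0 0 x ^ 4)
    {T : ℝ} (hT : 0 ≤ T) {R : ℝ} (hR : 0 ≤ R) :
    (∫ t in (0 : ℝ)..T, ∫ x in -R..R,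
        (β * ε * mixedD u 1 1 t x ^ 2 + β ^ 3 * ε * mixedD u 1 3 t x ^ 2))
      ≤ ∫ x, (mixedD u 0 0 0 x ^ 2 + 3 * β * mixedD u 0 1 0 x ^ 2
        + (3 * β ^ 2 + β * ε ^ 2) * mixedD u 0 2 0 x ^ 2
        + 2 * β ^ 3 * mixedD u 0 3 0 x ^ 2 + 1 / 2 * mixedD u 0 0 0 x ^ 4) := by
  have cA (k : ℕ) : Continuous fun p : ℝ × ℝ => mixedD u 0 k p.1 p.2 :=
    (hasDerivAt_iteratedDeriv_snd h.smooth k).1.continuous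
  have cB (k : ℕ) : Continuous fun p : ℝ × ℝ => mixedD u 1 k p.1 p.2 :=
    (contDiff_mixedD_one h.smooth k).continuous
  have cA' (k : ℕ) (t : ℝ) : Continuous fun x : ℝ => mixedD u 0 k t x :=
    (cA k).comp (by fun_prop : Continuous fun x : ℝ => (t, x))
  have dt (k : ℕ) := hasDerivAt_mixedD_fst h.smooth k
  have dA (k : ℕ) := (hasDerivAt_iteratedDeriv_snd h.smooth k).2
  have dB (k : ℕ) := hasDerivAt_mixedD_one_snd h.smooth k
  have int (k : ℕ) (hk : k ≤ 5) : Integrable fun x => mixedD u 0 k 0 x ^ 2 :=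
    h.sq_int 1 one_pos 0 k (by omega) 0 (by simp)
  have lim {j k : ℕ} (hjk : j + k ≤ 5) := h.tendsto_mixedD hT hjk
  have key := energy_add_dissipation_le (T := T) (R := R)
    (e := fun t x => mixedD u 0 0 t x ^ 2 + 3 * β * mixedD u 0 1 t x ^ 2
        + (3 * β ^ 2 + β * ε ^ 2) * mixedD u 0 2 t x ^ 2
        + 2 * β ^ 3 * mixedD u 0 3 t x ^ 2 + 1 / 2 * mixedD u 0 0 t x ^ 4)
    (et := fun t x => 2 * mixedD u 0 0 t x * mixedD u 1 0 t x
        + 6 * β * mixedD u 0 1 t x * mixedD u 1 1 t x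
        + 6 * β ^ 2 * mixedD u 0 2 t x * mixedD u 1 2 t x
        + 4 * β ^ 3 * mixedD u 0 3 t x * mixedD u 1 3 t x
        + 2 * β * ε ^ 2 * mixedD u 0 2 t x * mixedD u 1 2 t x
        + 2 * mixedD u 0 0 t x ^ 3 * mixedD u 1 0 t x)
    (f := fun t x =>
        (4 / 3 * mixedD u 0 0 t x ^ 3
          + 2 * β * (mixedD u 0 0 t x * mixedD u 0 2 t x) - β * mixedD u 0 1 t x ^ 2
          - 2 * β * (mixedD u 0 0 t x * mixedD u 1 1 t x)
          + 2 * β ^ 2 * (mixedD u 0 0 t x * mixedD u 1 3 t x)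
          - 2 * β ^ 2 * (mixedD u 0 1 t x * mixedD u 1 2 t x)
          - 2 * ε * (mixedD u 0 0 t x * mixedD u 0 1 t x))
        - (4 * β * (mixedD u 0 1 t x * mixedD u 1 0 t x)
          + 4 * β ^ 3 * (mixedD u 0 2 t x * mixedD u 1 3 t x)
          + 2 * β ^ 2 * mixedD u 0 2 t x ^ 2)
        - (2 * β * ε * (mixedD u 1 0 t x * mixedD u 1 1 t x)
          + 2 * β ^ 2 * ε * (mixedD u 0 2 t x * mixedD u 1 2 t x)
          + 2 * β ^ 3 * ε * (mixedD u 1 2 t x * mixedD u 1 3 t x))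
        + (4 / 5 * mixedD u 0 0 t x ^ 5
          + 2 * β * (mixedD u 0 0 t x ^ 3 * mixedD u 0 2 t x)
          - 2 * β * (mixedD u 0 0 t x ^ 3 * mixedD u 1 1 t x)
          + 2 * β ^ 2 * (mixedD u 0 0 t x ^ 3 * mixedD u 1 3 t x)
          - 2 * ε * (mixedD u 0 0 t x ^ 3 * mixedD u 0 1 t x)))
    (fx := fun t x =>
      (4 * mixedD u 0 0 t x ^ 2 * mixedD u 0 1 t x
          + 2 * β * mixedD u 0 0 t x * mixedD u 0 3 t x
          - 2 * β * (mixedD u 0 1 t x * mixedD u 1 1 t x + mixedD u 0 0 t x * mixedD u 1 2 t x)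
          + 2 * β ^ 2
            * (mixedD u 0 0 t x * mixedD u 1 4 t x - mixedD u 0 2 t x * mixedD u 1 2 t x)
          - 2 * ε * (mixedD u 0 1 t x ^ 2 + mixedD u 0 0 t x * mixedD u 0 2 t x))
        + 2 * (-2 * β
            * (mixedD u 0 2 t x * mixedD u 1 0 t x + mixedD u 0 1 t x * mixedD u 1 1 t x)
          - 2 * β ^ 3
            * (mixedD u 0 3 t x * mixedD u 1 3 t x + mixedD u 0 2 t x * mixedD u 1 4 t x)
          - 2 * β ^ 2 * mixedD u 0 2 t x * mixedD u 0 3 t x)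
        + (-2 * β * ε * (mixedD u 1 1 t x ^ 2 + mixedD u 1 0 t x * mixedD u 1 2 t x)
          - 2 * β ^ 2 * ε
            * (mixedD u 0 3 t x * mixedD u 1 2 t x + mixedD u 0 2 t x * mixedD u 1 3 t x)
          - 2 * β ^ 3 * ε * (mixedD u 1 3 t x ^ 2 + mixedD u 1 2 t x * mixedD u 1 4 t x))
        + (4 * mixedD u 0 0 t x ^ 4 * mixedD u 0 1 t x
          + 2 * β * (3 * mixedD u 0 0 t x ^ 2 * mixedD u 0 1 t x * mixedD u 0 2 t x
            + mixedD u 0 0 t x ^ 3 * mixedD u 0 3 t x)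
          - 2 * β * (3 * mixedD u 0 0 t x ^ 2 * mixedD u 0 1 t x * mixedD u 1 1 t x
            + mixedD u 0 0 t x ^ 3 * mixedD u 1 2 t x)
          + 2 * β ^ 2 * (3 * mixedD u 0 0 t x ^ 2 * mixedD u 0 1 t x * mixedD u 1 3 t x
            + mixedD u 0 0 t x ^ 3 * mixedD u 1 4 t x)
          - 2 * ε * (3 * mixedD u 0 0 t x ^ 2 * mixedD u 0 1 t x ^ 2
            + mixedD u 0 0 t x ^ 3 * mixedD u 0 2 t x)))
    (d := fun t x => β * ε * mixedD u 1 1 t x ^ 2 + β ^ 3 * ε * mixedD u 1 3 t x ^ 2) hT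
    (by simp only [Function.uncurry_def]; fun_prop) (by simp only [Function.uncurry_def]; fun_prop)
    (by simp only [Function.uncurry_def]; fun_prop) (fun t => by fun_prop)
    (fun t x => ((((((dt 0 t x).fun_pow 2).fun_add
      (((dt 1 t x).fun_pow 2).const_mul (3 * β))).fun_add
      (((dt 2 t x).fun_pow 2).const_mul (3 * β ^ 2 + β * ε ^ 2))).fun_add
      (((dt 3 t x).fun_pow 2).const_mul (2 * β ^ 3))).fun_add
      (((dt 0 t x).fun_pow 4).const_mul (1 / 2))).congr_deriv (by push_cast; ring))
    (fun t x => by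
      have e1 := (((((((dA 0 t x).fun_pow 3).const_mul (4 / 3)).fun_add
        (((dA 0 t x).fun_mul (dA 2 t x)).const_mul (2 * β))).fun_sub
        (((dA 1 t x).fun_pow 2).const_mul β)).fun_sub
        (((dA 0 t x).fun_mul (dB 1 t x)).const_mul (2 * β))).fun_add
        (((dA 0 t x).fun_mul (dB 3 t x)).const_mul (2 * β ^ 2))).fun_sub
        (((dA 1 t x).fun_mul (dB 2 t x)).const_mul (2 * β ^ 2)) |>.fun_sub
        (((dA 0 t x).fun_mul (dA 1 t x)).const_mul (2 * ε))
      have e2 := ((((dA 1 t x).fun_mul (dB 0 t x)).const_mul (4 * β)).fun_add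
        (((dA 2 t x).fun_mul (dB 3 t x)).const_mul (4 * β ^ 3))).fun_add
        (((dA 2 t x).fun_pow 2).const_mul (2 * β ^ 2))
      have e3 := ((((dB 0 t x).fun_mul (dB 1 t x)).const_mul (2 * β * ε)).fun_add
        (((dA 2 t x).fun_mul (dB 2 t x)).const_mul (2 * β ^ 2 * ε))).fun_add
        (((dB 2 t x).fun_mul (dB 3 t x)).const_mul (2 * β ^ 3 * ε))
      have c := (dA 0 t x).fun_pow 3
      have e4 := ((((((dA 0 t x).fun_pow 5).const_mul (4 / 5)).fun_add
        ((c.fun_mul (dA 2 t x)).const_mul (2 * β))).fun_sub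
        ((c.fun_mul (dB 1 t x)).const_mul (2 * β))).fun_add
        ((c.fun_mul (dB 3 t x)).const_mul (2 * β ^ 2))).fun_sub
        ((c.fun_mul (dA 1 t x)).const_mul (2 * ε))
      exact (((e1.fun_sub e2).fun_sub e3).fun_add e4).congr_deriv (by push_cast; ring))
    (fun t x => by positivity) (fun t x => by positivity)
    (((((int 0 (by simp)).add ((int 1 (by simp)).const_mul _)).add
      ((int 2 (by simp)).const_mul _)).add ((int 3 (by simp)).const_mul _)).add
      (hint.const_mul _))
    (fun t ht x => higher_energy_pointwise hε hβ (h.pde_mixedD ht.1 x) (hsmall t ht.1.le x))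
    (by
      have h00 := lim (j := 0) (k := 0) (by norm_num)
      have h01 := lim (j := 0) (k := 1) (by norm_num)
      have h02 := lim (j := 0) (k := 2) (by norm_num)
      have h10 := lim (j := 1) (k := 0) (by norm_num)
      have h11 := lim (j := 1) (k := 1) (by norm_num)
      have h12 := lim (j := 1) (k := 2) (by norm_num)
      have h13 := lim (j := 1) (k := 3) (by norm_num)
      have e1 := ((((((h00.pow 3).const_mul (4 / 3)).add
        ((h00.mul h02).const_mul (2 * β))).sub ((h01.pow 2).const_mul β)).sub
        ((h00.mul h11).const_mul (2 * β))).add ((h00.mul h13).const_mul (2 * β ^ 2))).sub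
        ((h01.mul h12).const_mul (2 * β ^ 2)) |>.sub ((h00.mul h01).const_mul (2 * ε))
      have e2 := (((h01.mul h10).const_mul (4 * β)).add
        ((h02.mul h13).const_mul (4 * β ^ 3))).add ((h02.pow 2).const_mul (2 * β ^ 2))
      have e3 := (((h10.mul h11).const_mul (2 * β * ε)).add
        ((h02.mul h12).const_mul (2 * β ^ 2 * ε))).add ((h12.mul h13).const_mul (2 * β ^ 3 * ε))
      have c := h00.pow 3
      have e4 := (((((h00.pow 5).const_mul (4 / 5)).add ((c.mul h02).const_mul (2 * β))).sub
        ((c.mul h11).const_mul (2 * β))).add ((c.mul h13).const_mul (2 * β ^ 2))).sub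
        ((c.mul h01).const_mul (2 * ε))
      convert ((e1.sub e2).sub e3).add e4 using 2
      simp)
    hR
  refine le_trans (le_add_of_nonneg_left ?_) key
  exact intervalIntegral.integral_nonneg (by linarith) fun x _ => by positivity

theorem IsAdmissibleKdVRLW.integral_weighted_sq_le (h : IsAdmissibleKdVRLW ε β u)
    {η : ℝ → ℝ} (hη : ContDiff ℝ 2 η) {M : ℝ} (hM : ∀ v, |deriv η v| ≤ M) {T : ℝ} (hT : 0 < T)
    {K : ℝ} (hdiss : ∀ R, 0 ≤ R → (∫ t in (0 : ℝ)..T, ∫ x in -R..R,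
      (β * ε * mixedD u 1 1 t x ^ 2 + β ^ 3 * ε * mixedD u 1 3 t x ^ 2)) ≤ K)
    {k : ℕ} (hk : k ≤ 4) {w c : ℝ} (hw : 0 < w) (hcw : c ^ 2 / w = β / ε)
    (hwle : ∀ t x, w * mixedD u 1 k t x ^ 2
      ≤ β * ε * mixedD u 1 1 t x ^ 2 + β ^ 3 * ε * mixedD u 1 3 t x ^ 2) :
    (∫ t in (0 : ℝ)..T, ∫ x, (c * deriv η (u t x) * mixedD u 1 k t x) ^ 2)
      ≤ K * M ^ 2 * (β / ε) := by
  have hη' : Continuous (deriv η) := hη.continuous_deriv (by norm_num)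
  have hu' : Continuous fun p : ℝ × ℝ => u p.1 p.2 := h.smooth.continuous
  have sec (j : ℕ) (t : ℝ) : Continuous fun x => mixedD u 1 j t x :=
    (contDiff_mixedD_one h.smooth j).continuous.comp (by fun_prop : Continuous fun x : ℝ => (t, x))
  have par {F : ℝ → ℝ → ℝ} (hF : Continuous (Function.uncurry F)) (R : ℝ) :
      IntervalIntegrable (fun t => ∫ x in -R..R, F t x) volume 0 T :=
    (intervalIntegral.continuous_parametric_intervalIntegral_of_continuous'
      hF _ _).intervalIntegrable _ _
  have c1 := (contDiff_mixedD_one h.smooth 1).continuous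
  have c3 := (contDiff_mixedD_one h.smooth 3).continuous
  have ck := (contDiff_mixedD_one h.smooth k).continuous
  refine (integral_integral_sq_le (g := mixedD u 1 k) (K := K / w)
    (m := c ^ 2 * M ^ 2) hT.le (by positivity) ck ?_ (fun t x => ?_)
    (fun t ht => h.sq_int T hT 1 k (by omega) t ht) fun R hR => ?_).trans_eq ?_
  · simp only [Function.uncurry_def]
    fun_prop
  · have : deriv η (u t x) ^ 2 ≤ M ^ 2 := sq_le_sq' (abs_le.1 (hM _)).1 (abs_le.1 (hM _)).2
    rw [mul_pow, mul_pow]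
    gcongr
  · rw [le_div_iff₀ hw, mul_comm]
    refine le_trans ?_ (hdiss R hR)
    rw [← intervalIntegral.integral_const_mul]
    simp only [← intervalIntegral.integral_const_mul]
    refine intervalIntegral.integral_mono_on hT.le
      (par (F := fun t x => w * mixedD u 1 k t x ^ 2)
        (by simp only [Function.uncurry_def]; fun_prop) R)
      (par (by simp only [Function.uncurry_def]; fun_prop) R) fun t _ => ?_
    have s1 := sec 1 t
    have s3 := sec 3 t
    have sk := sec k t
    exact intervalIntegral.integral_mono_on (by linarith)
      (Continuous.intervalIntegrable (by fun_prop) _ _)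
      (Continuous.intervalIntegrable (by fun_prop) _ _) fun x _ => hwle t x
  · rw [← hcw]
    ring

end Admissible

/-- The `H⁻¹`-type terms `I₅` and `I₇` vanish: `L²` bounds on
`β η′(u) ∂ₜ∂ₓu` and `β² η′(u) ∂ₜ∂ₓ³u`. -/
theorem I5_I7_vanish_KdVRLW (C0 : ℝ) (hC0 : 0 < C0) :
    ∃ D : ℝ, 0 < D ∧ ∃ C : ℝ, 0 < C ∧
      ∀ ε β : ℝ, 0 < ε → 0 < β → β ≤ D ^ 2 * ε ^ 4 →
        ∀ u : ℝ → ℝ → ℝ, IsAdmissibleKdVRLW ε β u →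
          DataBoundsKdVRLW ε β C0 (u 0) →
          ∀ η : ℝ → ℝ, ContDiff ℝ 2 η →
            ∀ M : ℝ, (∀ v : ℝ, |deriv η v| ≤ M) →
              ∀ T > (0 : ℝ),
                ((∫ t in (0 : ℝ)..T, ∫ x : ℝ,
                      (β * deriv η (u t x) * mixedD u 1 1 t x) ^ 2)
                    ≤ C * M ^ 2 * (β / ε) ∧
                  C * M ^ 2 * (β / ε) ≤ C * M ^ 2 * D ^ 2 * ε ^ 3) ∧
                ((∫ t in (0 : ℝ)..T, ∫ x : ℝ,
                      (β ^ 2 * deriv η (u t x) * mixedD u 1 3 t x) ^ 2)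
                    ≤ C * M ^ 2 * (β / ε) ∧
                  C * M ^ 2 * (β / ε) ≤ C * M ^ 2 * D ^ 2 * ε ^ 3) := by
  have hν : (0 : ℝ) < 1 / (18 * C0) := by positivity
  refine ⟨1 / (18 * C0), hν, 8 * C0, by positivity, ?_⟩
  intro ε β hε hβ hβε u hu hdata η hη M hM T hT
  have hβε' : β / ε ≤ (1 / (18 * C0)) ^ 2 * ε ^ 3 := by
    rw [div_le_iff₀ hε]
    linarith
  have hright : 8 * C0 * M ^ 2 * (β / ε) ≤ 8 * C0 * M ^ 2 * (1 / (18 * C0)) ^ 2 * ε ^ 3 := by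
    rw [mul_assoc (8 * C0 * M ^ 2)]
    exact mul_le_mul_of_nonneg_left hβε' (by positivity)
  have int (k : ℕ) (hk : k ≤ 5) : Integrable fun x => mixedD u 0 k 0 x ^ 2 :=
    hu.sq_int 1 one_pos 0 k (by omega) 0 (by simp)
  have hs0 : 0 < √β := Real.sqrt_pos.2 hβ
  have hs2 : √β ^ 2 = β := Real.sq_sqrt hβ.le
  obtain ⟨hdata1, hdata2, -⟩ := hdata
  have hdat (k : ℕ) : (∫ x, iteratedDeriv k (u 0) x ^ 2) = ∫ x, mixedD u 0 k 0 x ^ 2 := by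
    simp only [mixedD, iteratedDeriv_zero]
  have hdat0 : (∫ x, u 0 x ^ 2) = ∫ x, mixedD u 0 0 0 x ^ 2 := by
    simp only [mixedD, iteratedDeriv_zero]
  have hdat4 : (∫ x, u 0 x ^ 4) = ∫ x, mixedD u 0 0 0 x ^ 4 := by
    simp only [mixedD, iteratedDeriv_zero]
  rw [hdat0, hdat4, ← iteratedDeriv_one, hdat 1] at hdata1
  rw [hdat 2, hdat 3] at hdata2
  have n4 : 0 ≤ ∫ x, mixedD u 0 0 0 x ^ 4 := integral_nonneg fun x => by positivity
  have n0 : 0 ≤ ∫ x, mixedD u 0 0 0 x ^ 2 := integral_nonneg fun x => by positivity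
  have n1 : 0 ≤ ∫ x, mixedD u 0 1 0 x ^ 2 := integral_nonneg fun x => by positivity
  have n2 : 0 ≤ ∫ x, mixedD u 0 2 0 x ^ 2 := integral_nonneg fun x => by positivity
  have n3 : 0 ≤ ∫ x, mixedD u 0 3 0 x ^ 2 := integral_nonneg fun x => by positivity
  set I0 := ∫ x, mixedD u 0 0 0 x ^ 2
  set I1 := ∫ x, mixedD u 0 1 0 x ^ 2
  set I2 := ∫ x, mixedD u 0 2 0 x ^ 2
  set I3 := ∫ x, mixedD u 0 3 0 x ^ 2
  set I4 := ∫ x, mixedD u 0 0 0 x ^ 4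
  have m1 : 0 ≤ β * I1 := by positivity
  have m1' : 0 ≤ ε ^ 2 * I1 := by positivity
  have m2 : 0 ≤ β * ε * I2 := by positivity
  have m2' : 0 ≤ β * ε ^ 2 * I2 := by positivity
  have m2'' : 0 ≤ β ^ 2 * I2 := by positivity
  have m3 : 0 ≤ β ^ 2 * ε ^ 2 * I3 := by positivity
  have m3' : 0 ≤ β ^ 3 * I3 := by positivity
  have hE1 : (∫ x, (mixedD u 0 0 0 x ^ 2 + β * mixedD u 0 1 0 x ^ 2
      + β ^ 2 * mixedD u 0 2 0 x ^ 2)) ≤ 2 * C0 := by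
    rw [integral_add ((int 0 (by simp)).fun_add ((int 1 (by simp)).const_mul _))
      ((int 2 (by simp)).const_mul _),
      integral_add (int 0 (by simp)) ((int 1 (by simp)).const_mul _),
      integral_const_mul, integral_const_mul]
    linarith
  have hsup (t : ℝ) (ht : 0 ≤ t) (x : ℝ) : √β * mixedD u 0 0 t x ^ 2 ≤ 2 * C0 :=
    hu.sqrt_mul_sq_le hε hβ hE1 ht x
  have hsqrt : √β ≤ 1 / (18 * C0) * ε ^ 2 := by
    refine Real.sqrt_le_iff.2 ⟨by positivity, ?_⟩
    linarith
  have hsmall (t : ℝ) (ht : 0 ≤ t) (x : ℝ) : β * mixedD u 0 0 t x ^ 2 ≤ ε ^ 2 / 9 := by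
    calc β * mixedD u 0 0 t x ^ 2 = √β * (√β * mixedD u 0 0 t x ^ 2) := by
          rw [← mul_assoc, ← pow_two, hs2]
      _ ≤ 1 / (18 * C0) * ε ^ 2 * (2 * C0) :=
          mul_le_mul hsqrt (hsup t ht x) (by positivity) (by positivity)
      _ = ε ^ 2 / 9 := by field_simp; norm_num
  have int4 : Integrable fun x => mixedD u 0 0 0 x ^ 4 := by
    have cA : Continuous fun x : ℝ => mixedD u 0 0 0 x :=
      (hasDerivAt_iteratedDeriv_snd hu.smooth 0).1.continuous.comp
        (by fun_prop : Continuous fun x : ℝ => ((0 : ℝ), x))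
    refine ((int 0 (by simp)).const_mul (2 * C0 / √β)).mono' (cA.pow 4).aestronglyMeasurable
      (.of_forall fun x => ?_)
    rw [Real.norm_of_nonneg (by positivity)]
    have : mixedD u 0 0 0 x ^ 2 ≤ 2 * C0 / √β := by
      rw [le_div_iff₀ hs0, mul_comm]
      exact hsup 0 le_rfl x
    calc mixedD u 0 0 0 x ^ 4 = mixedD u 0 0 0 x ^ 2 * mixedD u 0 0 0 x ^ 2 := by ring
      _ ≤ 2 * C0 / √β * mixedD u 0 0 0 x ^ 2 := mul_le_mul_of_nonneg_right this (sq_nonneg _)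
  have hE2 : (∫ x, (mixedD u 0 0 0 x ^ 2 + 3 * β * mixedD u 0 1 0 x ^ 2
      + (3 * β ^ 2 + β * ε ^ 2) * mixedD u 0 2 0 x ^ 2
      + 2 * β ^ 3 * mixedD u 0 3 0 x ^ 2 + 1 / 2 * mixedD u 0 0 0 x ^ 4)) ≤ 8 * C0 := by
    have j0 := int 0 (by simp)
    have j1 := (int 1 (by simp)).const_mul (3 * β)
    have j2 := (int 2 (by simp)).const_mul (3 * β ^ 2 + β * ε ^ 2)
    have j3 := (int 3 (by simp)).const_mul (2 * β ^ 3)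
    rw [integral_add (((j0.fun_add j1).fun_add j2).fun_add j3) (int4.const_mul _),
      integral_add ((j0.fun_add j1).fun_add j2) j3, integral_add (j0.fun_add j1) j2,
      integral_add j0 j1, integral_const_mul, integral_const_mul, integral_const_mul,
      integral_const_mul]
    linarith
  have hdiss (R : ℝ) (hR : 0 ≤ R) :=
    (hu.integral_higher_dissipation_le hε hβ hsmall int4 hT.le hR).trans hE2
  have bound {k : ℕ} (hk : k ≤ 4) {w c : ℝ} (hw : 0 < w) (hcw : c ^ 2 / w = β / ε) :=
    hu.integral_weighted_sq_le hη hM hT hdiss hk hw hcw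
  refine ⟨⟨bound (k := 1) (w := β * ε) (c := β) (by norm_num) (by positivity) (by field_simp)
    fun t x => le_add_of_nonneg_right (by positivity), hright⟩,
    bound (k := 3) (w := β ^ 3 * ε) (c := β ^ 2) (by norm_num) (by positivity) (by field_simp)
    fun t x => le_add_of_nonneg_left (by positivity), hright⟩

end
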